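/- arXiv:1705.08592 — 2 statements merged into one kernel-verified Lean document; each statement's English description precedes it below -/
import Mathlib

section
/- For every integer n ≥ 1 and every subset X ⊆ V(G_n), ∑_{0≤j≤k−1} c_{2j+1}(G_n−X) ≤ ((32k+141)/(72k−78))·|X|. -/
open SimpleGraph

/-- `l = 2⌊(k-12)/17⌋`. -/
def lP (k : ℕ) : ℕ := 2 * ((k - 12) / 17)

/-- `m = ⌊(2k-l+1)/8⌋`. -/
def mP (k : ℕ) : ℕ := (2 * k - lP k + 1) / 8

/-- `r = 2k+1-l-8m`. -/
def rP (k : ℕ) : ℕ := 2 * k + 1 - lP k - 8 * mP k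

/-- The graph `H` on 8 vertices `x₁, …, x₈` (represented by `0, …, 7`): the cycle
`x₁x₂⋯x₈x₁` together with the chords `x₂x₄, x₄x₆, x₆x₈, x₈x₂`; `u = x₁ = 0`, `v = x₅ = 4`. -/
def Hgraph : SimpleGraph (Fin 8) :=
  SimpleGraph.fromRel (fun a b =>
    b.val = (a.val + 1) % 8 ∨ (a.val % 2 = 1 ∧ b.val = (a.val + 2) % 8))

/-- The vertex type of the graph `T`: `m` disjoint copies of `H` together with a set `R`
of `r` further vertices. -/
abbrev TV (k : ℕ) : Type := (Fin (mP k) × Fin 8) ⊕ Fin (rP k)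

/-- Membership in `U ∪ R`, where `U = {uᵢ, vᵢ : 1 ≤ i ≤ m}` consists of the copies of
`u = x₁ = 0` and `v = x₅ = 4`, and `R` is the set of `r` extra vertices. -/
def inUR (k : ℕ) : TV k → Prop
  | Sum.inl (_, a) => a = 0 ∨ a = 4
  | Sum.inr _ => True

/-- The graph `T`: the disjoint union `H₁ ∪ ⋯ ∪ H_m` together with the vertices of `R`,
where all pairs of distinct vertices of `U ∪ R` are joined. -/
def Tgraph (k : ℕ) : SimpleGraph (TV k) :=
  SimpleGraph.fromRel (fun s t =>
    (match s, t with
      | Sum.inl (i, a), Sum.inl (j, b) => i = j ∧ Hgraph.Adj a b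
      | _, _ => False) ∨ (inUR k s ∧ inUR k t))

/-- The vertex type of `Q = L + T` where `L` is a complete graph of order `l`. -/
abbrev QV (k : ℕ) : Type := Fin (lP k) ⊕ TV k

/-- The graph `Q = L + T`, the join of the complete graph `L` of order `l` with `T`. -/
def Qgraph (k : ℕ) : SimpleGraph (QV k) :=
  SimpleGraph.fromRel (fun x y =>
    match x, y with
    | Sum.inl _, _ => True
    | Sum.inr s, Sum.inr t => (Tgraph k).Adj s t
    | _, _ => False)


/-- The vertex type of `G_n`: a complete graph `Q₀` of order `n` joined to `2n+1` disjoint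
copies of `Q`. -/
abbrev GV (k n : ℕ) : Type := Fin n ⊕ (Fin (2 * n + 1) × QV k)

/-- The graph `G_n = Q₀ + (Q₁ ∪ ⋯ ∪ Q_{2n+1})`: the join of a complete graph `Q₀` of order
`n` with the disjoint union of `2n+1` copies of `Q`. -/
def Ggraph (k n : ℕ) : SimpleGraph (GV k n) :=
  SimpleGraph.fromRel (fun x y =>
    match x, y with
    | Sum.inl _, _ => True
    | Sum.inr (i, s), Sum.inr (j, t) => i = j ∧ (Qgraph k).Adj s t
    | _, _ => False)

/-- The number of connected components of `G - X` having exactly `j` vertices. -/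
noncomputable def cComp {V : Type*} (G : SimpleGraph V) (X : Set V) (j : ℕ) : ℕ :=
  Nat.card {C : (G.induce Xᶜ).ConnectedComponent // Nat.card C.supp = j}

open Classical in
/-- The trace of `S` on the `i`-th fibre of `e`. -/
noncomputable def fibre {V W ι : Type*} [Fintype W] (e : ι × W → V) (i : ι) (S : Finset V) :
    Finset W :=
  Finset.univ.filter fun w => e (i, w) ∈ S

lemma mem_fibre {V W ι : Type*} [Fintype W] (e : ι × W → V) (i : ι) (S : Finset V) (w : W) :
    w ∈ fibre e i S ↔ e (i, w) ∈ S := by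
  simp [fibre]

lemma card_fibre {V W ι : Type*} [Fintype W] [DecidableEq V] (e : ι × W → V) (i : ι)
    (S : Finset V) : (fibre e i S).card = ∑ w, if e (i, w) ∈ S then 1 else 0 := by
  classical
  rw [fibre, Finset.card_filter]
  exact Finset.sum_congr rfl fun w _ => by congr

lemma card_eq_sum_ite {V : Type*} [Fintype V] [DecidableEq V] (S : Finset V) :
    S.card = ∑ v, if v ∈ S then 1 else 0 := by
  simp

lemma card_fibre_le {V W ι : Type*} [Fintype W] {e : ι × W → V} (he : Function.Injective e)
    (i : ι) (S : Finset V) : (fibre e i S).card ≤ S.card := by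
  refine Finset.card_le_card_of_injOn (fun w => e (i, w)) ?_ ?_
  · intro w hw
    exact (mem_fibre e i S w).1 hw
  · intro a _ b _ h
    simpa using he h

lemma card_eq_sum_fibre {V W ι : Type*} [Fintype W] [Fintype ι] {e : ι × W → V}
    (he : Function.Injective e) (S : Finset V) (hS : ∀ x ∈ S, ∃ p, e p = x) :
    S.card = ∑ i, (fibre e i S).card := by
  classical
  simp only [card_fibre]
  rw [← Fintype.sum_prod_type (f := fun p : ι × W => if e p ∈ S then 1 else 0),
    ← Finset.card_filter, ← Finset.card_image_of_injective _ he]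
  congr 1
  ext x
  simp only [Finset.mem_image, Finset.mem_filter, Finset.mem_univ, true_and]
  constructor
  · intro hx
    obtain ⟨p, rfl⟩ := hS x hx
    exact ⟨p, hx, rfl⟩
  · rintro ⟨p, hp, rfl⟩
    exact hp

/-- A set of odd size avoiding `X` and closed under adjacency in `G - X`. -/
structure OddClosed {V : Type*} (G : SimpleGraph V) (X S : Finset V) : Prop where
  odd : Odd S.card
  notMem : ∀ x ∈ S, x ∉ X
  closed : ∀ x ∈ S, ∀ y, y ∉ X → G.Adj x y → y ∈ S

lemma OddClosed.nonempty {V : Type*} {G : SimpleGraph V} {X S : Finset V}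
    (h : OddClosed G X S) : S.Nonempty := Finset.card_pos.1 h.odd.pos

lemma eq_of_mem_of_mem {V : Type*} {F : Finset (Finset V)}
    (hF : (F : Set (Finset V)).PairwiseDisjoint id) {S T : Finset V} (hS : S ∈ F) (hT : T ∈ F)
    {x : V} (hx : x ∈ S) (hx' : x ∈ T) : S = T := by
  by_contra h
  exact Finset.disjoint_left.1 (hF hS hT h) hx hx'

/-- A pairwise disjoint family of odd sets covered by the fibres of `e` is bounded by the sum of
bounds for the odd traces on the fibres. -/
lemma card_le_sum_of_fibres {V W ι : Type*} [Fintype W] [Fintype ι] {e : ι × W → V}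
    (he : Function.Injective e) (F : Finset (Finset V))
    (hF : (F : Set (Finset V)).PairwiseDisjoint id) (hodd : ∀ S ∈ F, Odd S.card)
    (hcov : ∀ S ∈ F, ∀ x ∈ S, ∃ p, e p = x) (b : ι → ℝ)
    (hb : ∀ i, ∀ F' : Finset (Finset W), (F' : Set (Finset W)).PairwiseDisjoint id →
      (∀ T ∈ F', Odd T.card ∧ ∃ S ∈ F, T = fibre e i S) → (F'.card : ℝ) ≤ b i) :
    (F.card : ℝ) ≤ ∑ i, b i := by
  classical
  have hex : ∀ S ∈ F, ∃ i, Odd (fibre e i S).card := by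
    intro S hS
    by_contra! h
    have h1 := hodd S hS
    rw [card_eq_sum_fibre he S (hcov S hS), ← Nat.not_even_iff_odd] at h1
    exact h1 (Finset.even_sum _ fun i _ => Nat.not_odd_iff_even.1 (h i))
  rcases isEmpty_or_nonempty ι with hι | hι
  · have hF0 : F = ∅ := Finset.eq_empty_of_forall_notMem fun S hS =>
      isEmptyElim (hex S hS).choose
    simp [hF0]
  choose! c hc using hex
  rw [Finset.card_eq_sum_card_fiberwise (f := c) (t := Finset.univ) (fun _ _ => by simp)]
  push_cast
  refine Finset.sum_le_sum fun i _ => ?_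
  have hinj : Set.InjOn (fibre e i) (F.filter fun S => c S = i : Finset (Finset V)) := by
    intro S hS T hT h
    simp only [Finset.coe_filter, Set.mem_ofPred_eq] at hS hT
    have h1 := hc S hS.1
    rw [hS.2] at h1
    obtain ⟨w, hw⟩ := Finset.card_pos.1 h1.pos
    have hw' := hw
    rw [h] at hw'
    exact eq_of_mem_of_mem hF hS.1 hT.1 ((mem_fibre _ _ _ _).1 hw) ((mem_fibre _ _ _ _).1 hw')
  rw [← Finset.card_image_of_injOn hinj]
  refine hb i _ ?_ ?_
  · intro A hA B hB hAB
    simp only [Finset.coe_image, Finset.coe_filter, Set.mem_image, Set.mem_ofPred_eq] at hA hB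
    obtain ⟨S, ⟨hS, -⟩, rfl⟩ := hA
    obtain ⟨T, ⟨hT, -⟩, rfl⟩ := hB
    refine Finset.disjoint_left.2 fun w hw hw' => hAB ?_
    rw [eq_of_mem_of_mem hF hS hT ((mem_fibre _ _ _ _).1 hw) ((mem_fibre _ _ _ _).1 hw')]
  · intro A hA
    simp only [Finset.mem_image, Finset.mem_filter] at hA
    obtain ⟨S, ⟨hS, hSi⟩, rfl⟩ := hA
    have h1 := hc S hS
    rw [hSi] at h1
    exact ⟨h1, S, hS, rfl⟩

lemma OddClosed.fibre {V W ι : Type*} [Fintype W] {e : ι × W → V} {G : SimpleGraph V}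
    {G' : SimpleGraph W} {X S : Finset V} (h : OddClosed G X S) (i : ι)
    (hG : ∀ a b, G'.Adj a b → G.Adj (e (i, a)) (e (i, b)))
    (hodd : Odd (fibre e i S).card) : OddClosed G' (fibre e i X) (fibre e i S) where
  odd := hodd
  notMem x hx := by
    rw [mem_fibre] at hx ⊢
    exact h.notMem _ hx
  closed x hx y hy hxy := by
    rw [mem_fibre] at hx hy ⊢
    exact h.closed _ hx _ hy (hG _ _ hxy)

section Dominating

variable {V : Type*} {G : SimpleGraph V} {X : Finset V} {v : V}

lemma OddClosed.mem_of_dominating {S : Finset V} (h : OddClosed G X S) (hv : v ∉ X)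
    (hd : ∀ x, x ≠ v → G.Adj x v) : v ∈ S := by
  obtain ⟨x, hx⟩ := h.nonempty
  by_cases hxv : x = v
  · exact hxv ▸ hx
  · exact h.closed x hx v hv (hd x hxv)

lemma OddClosed.card_add_of_dominating [Fintype V] {S : Finset V} (h : OddClosed G X S)
    (hv : v ∉ X) (hd : ∀ x, x ≠ v → G.Adj x v) : S.card + X.card = Fintype.card V := by
  classical
  have hvS := h.mem_of_dominating hv hd
  have hS : S = Xᶜ := by
    ext x
    rw [Finset.mem_compl]
    refine ⟨h.notMem x, fun hx => ?_⟩
    by_cases hxv : x = v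
    · exact hxv ▸ hvS
    · exact h.closed v hvS x hx (hd x hxv).symm
  rw [hS, Finset.card_compl_add_card]

lemma card_le_one_of_dominating {F : Finset (Finset V)}
    (hF : (F : Set (Finset V)).PairwiseDisjoint id) (hO : ∀ S ∈ F, OddClosed G X S)
    (hv : v ∉ X) (hd : ∀ x, x ≠ v → G.Adj x v) : F.card ≤ 1 :=
  Finset.card_le_one.2 fun S hS T hT => eq_of_mem_of_mem hF hS hT
    ((hO S hS).mem_of_dominating hv hd) ((hO T hT).mem_of_dominating hv hd)

end Dominating

instance : DecidableRel Hgraph.Adj := fun a b =>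
  decidable_of_iff (a ≠ b ∧ ((b.val = (a.val + 1) % 8 ∨ (a.val % 2 = 1 ∧ b.val = (a.val + 2) % 8)) ∨
    (a.val = (b.val + 1) % 8 ∨ (b.val % 2 = 1 ∧ a.val = (b.val + 2) % 8)))) Iff.rfl

/-- The number of vertices of `H` outside a set `A` avoiding `0` and `4` with a neighbour in `A`,
where `aᵢ` tells whether the vertex `i` belongs to `A`. -/
def boundaryCount (a₁ a₂ a₃ a₅ a₆ a₇ : Bool) : ℕ :=
  (a₁ || a₇).toNat + (!a₁ && (a₂ || a₃ || a₇)).toNat + (!a₂ && (a₁ || a₃)).toNat +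
    (!a₃ && (a₁ || a₂ || a₅)).toNat + (a₃ || a₅).toNat + (!a₅ && (a₃ || a₆ || a₇)).toNat +
    (!a₆ && (a₅ || a₇)).toNat + (!a₇ && (a₁ || a₅ || a₆)).toNat

lemma two_le_boundaryCount : ∀ a₁ a₂ a₃ a₅ a₆ a₇ : Bool,
    (a₁ ^^ a₂ ^^ a₃ ^^ a₅ ^^ a₆ ^^ a₇) = true → 2 ≤ boundaryCount a₁ a₂ a₃ a₅ a₆ a₇ := by
  decide +kernel

lemma four_le_boundaryCount : ∀ a₁ a₂ a₃ a₅ a₆ a₇ : Bool,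
    (a₁ ^^ a₂ ^^ a₃ ^^ a₅ ^^ a₆ ^^ a₇) = true → ∀ b₁ b₂ b₃ b₅ b₆ b₇ : Bool,
    (b₁ ^^ b₂ ^^ b₃ ^^ b₅ ^^ b₆ ^^ b₇) = true →
    (a₁ && (b₁ || b₂ || b₃ || b₇) || a₂ && (b₁ || b₂ || b₃) || a₃ && (b₁ || b₂ || b₃ || b₅) ||
      a₅ && (b₃ || b₅ || b₆ || b₇) || a₆ && (b₅ || b₆ || b₇) ||
      a₇ && (b₁ || b₅ || b₆ || b₇)) = false →
    4 ≤ boundaryCount (a₁ || b₁) (a₂ || b₂) (a₃ || b₃) (a₅ || b₅) (a₆ || b₆) (a₇ || b₇) := by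
  decide +kernel

lemma boundaryCount_le {X U : Finset (Fin 8)} (h0 : 0 ∉ U) (h4 : 4 ∉ U)
    (hU : ∀ x ∈ U, ∀ y, y ∉ X → Hgraph.Adj x y → y ∈ U) :
    boundaryCount (decide (1 ∈ U)) (decide (2 ∈ U)) (decide (3 ∈ U)) (decide (5 ∈ U))
      (decide (6 ∈ U)) (decide (7 ∈ U)) ≤ X.card := by
  have hX : X.card = ∑ y, (decide (y ∈ X)).toNat := by
    rw [card_eq_sum_ite]
    exact Finset.sum_congr rfl fun y _ => by by_cases h : y ∈ X <;> simp [h]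
  have key : ∀ x y, Hgraph.Adj x y → y ∉ U → x ∈ U → y ∈ X := fun x y hxy hy hx => by
    by_contra hyX
    exact hy (hU x hx y hyX hxy)
  have toNat_le : ∀ b c : Bool, (b = true → c = true) → b.toNat ≤ c.toNat := by decide
  rw [hX, Fin.sum_univ_eight]
  unfold boundaryCount
  gcongr <;> refine toNat_le _ _ fun h => ?_ <;>
    simp only [Bool.or_eq_true, Bool.and_eq_true, Bool.not_eq_true', decide_eq_true_eq,
      decide_eq_false_iff_not] at h ⊢
  · rcases h with h | h <;> exact key _ _ (by decide) h0 h
  · rcases h with ⟨hn, (h | h) | h⟩ <;> exact key _ _ (by decide) hn h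
  · rcases h with ⟨hn, h | h⟩ <;> exact key _ _ (by decide) hn h
  · rcases h with ⟨hn, (h | h) | h⟩ <;> exact key _ _ (by decide) hn h
  · rcases h with h | h <;> exact key _ _ (by decide) h4 h
  · rcases h with ⟨hn, (h | h) | h⟩ <;> exact key _ _ (by decide) hn h
  · rcases h with ⟨hn, h | h⟩ <;> exact key _ _ (by decide) hn h
  · rcases h with ⟨hn, (h | h) | h⟩ <;> exact key _ _ (by decide) hn h

lemma xor_mem_of_odd {S : Finset (Fin 8)} (h0 : 0 ∉ S) (h4 : 4 ∉ S) (h : Odd S.card) :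
    (decide (1 ∈ S) ^^ decide (2 ∈ S) ^^ decide (3 ∈ S) ^^ decide (5 ∈ S) ^^ decide (6 ∈ S) ^^
      decide (7 ∈ S)) = true := by
  have hS : S.card = ∑ y, (decide (y ∈ S)).toNat := by
    rw [card_eq_sum_ite]
    exact Finset.sum_congr rfl fun y _ => by by_cases h : y ∈ S <;> simp [h]
  rw [hS, Fin.sum_univ_eight, decide_eq_false h0, decide_eq_false h4] at h
  generalize decide (1 ∈ S) = a₁, decide (2 ∈ S) = a₂, decide (3 ∈ S) = a₃, decide (5 ∈ S) = a₅,
    decide (6 ∈ S) = a₆, decide (7 ∈ S) = a₇ at h ⊢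
  revert a₁ a₂ a₃ a₅ a₆ a₇
  decide +kernel

lemma not_independent_hgraph : ∀ a b c : Fin 8, a ∈ ({1, 2, 3, 5, 6, 7} : Finset (Fin 8)) →
    b ∈ ({1, 2, 3, 5, 6, 7} : Finset (Fin 8)) → c ∈ ({1, 2, 3, 5, 6, 7} : Finset (Fin 8)) →
    a ≠ b → a ≠ c → b ≠ c → Hgraph.Adj a b ∨ Hgraph.Adj a c ∨ Hgraph.Adj b c := by
  decide +kernel

lemma subset_of_avoid {S : Finset (Fin 8)} (h : 0 ∉ S ∧ 4 ∉ S) :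
    S ⊆ ({1, 2, 3, 5, 6, 7} : Finset (Fin 8)) := by
  intro x hx
  have key : ∀ x : Fin 8, x ≠ 0 → x ≠ 4 → x ∈ ({1, 2, 3, 5, 6, 7} : Finset (Fin 8)) := by decide
  exact key x (fun h' => h.1 (h' ▸ hx)) fun h' => h.2 (h' ▸ hx)

/-- Counting odd closed sets of `H - X` which avoid `u` and `v`. -/
lemma card_oddClosed_hgraph (X : Finset (Fin 8)) (F : Finset (Finset (Fin 8)))
    (hF : (F : Set (Finset (Fin 8))).PairwiseDisjoint id)
    (hO : ∀ S ∈ F, OddClosed Hgraph X S) (hav : ∀ S ∈ F, 0 ∉ S ∧ 4 ∉ S) :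
    F.card ≤ 2 ∧ 2 * F.card ≤ X.card := by
  have h2 : F.card ≤ 2 := by
    by_contra! h
    obtain ⟨A, hA, B, hB, C, hC, hAB, hAC, hBC⟩ := Finset.two_lt_card.1 h
    obtain ⟨a, ha⟩ := (hO A hA).nonempty
    obtain ⟨b, hb⟩ := (hO B hB).nonempty
    obtain ⟨c, hc⟩ := (hO C hC).nonempty
    have key : ∀ S ∈ F, ∀ T ∈ F, ∀ s ∈ S, ∀ t ∈ T, Hgraph.Adj s t → S = T :=
      fun S hS T hT s hs t ht hst =>
        eq_of_mem_of_mem hF hS hT ((hO S hS).closed s hs t ((hO T hT).notMem t ht) hst) ht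
    have ne : ∀ S ∈ F, ∀ T ∈ F, ∀ s ∈ S, ∀ t ∈ T, S ≠ T → s ≠ t :=
      fun S hS T hT s hs t ht hST hst => hST (eq_of_mem_of_mem hF hS hT hs (hst ▸ ht))
    rcases not_independent_hgraph a b c (subset_of_avoid (hav A hA) ha)
      (subset_of_avoid (hav B hB) hb) (subset_of_avoid (hav C hC) hc)
      (ne A hA B hB a ha b hb hAB) (ne A hA C hC a ha c hc hAC) (ne B hB C hC b hb c hc hBC)
      with h | h | h
    · exact hAB (key A hA B hB a ha b hb h)
    · exact hAC (key A hA C hC a ha c hc h)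
    · exact hBC (key B hB C hC b hb c hc h)
  refine ⟨h2, ?_⟩
  rcases Nat.lt_or_ge F.card 2 with h | h
  · rcases Nat.eq_zero_or_pos F.card with h0 | h0
    · omega
    · obtain ⟨A, hA⟩ := Finset.card_pos.1 h0
      have h1 := two_le_boundaryCount _ _ _ _ _ _
        (xor_mem_of_odd (hav A hA).1 (hav A hA).2 (hO A hA).odd)
      have h3 := boundaryCount_le (hav A hA).1 (hav A hA).2 (hO A hA).closed
      omega
  · obtain ⟨A, hA, B, hB, hAB⟩ := Finset.one_lt_card.1 h
    have key : ∀ x ∈ A, ∀ y ∈ B, x ≠ y ∧ ¬ Hgraph.Adj x y := by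
      intro x hx y hy
      refine ⟨?_, fun hxy => ?_⟩
      · rintro rfl
        exact hAB (eq_of_mem_of_mem hF hA hB hx hy)
      · exact hAB (eq_of_mem_of_mem hF hA hB
          ((hO A hA).closed x hx y ((hO B hB).notMem y hy) hxy) hy)
    have no : ∀ x y, (x = y ∨ Hgraph.Adj x y) → x ∈ A → y ∈ B → False := fun x y hxy hx hy =>
      hxy.elim (key x hx y hy).1 (key x hx y hy).2
    have h1 := four_le_boundaryCount _ _ _ _ _ _
      (xor_mem_of_odd (hav A hA).1 (hav A hA).2 (hO A hA).odd) _ _ _ _ _ _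
      (xor_mem_of_odd (hav B hB).1 (hav B hB).2 (hO B hB).odd) (by
        rw [Bool.eq_false_iff]
        intro hc
        simp only [Bool.or_eq_true, Bool.and_eq_true, decide_eq_true_eq, or_assoc] at hc
        rcases hc with ⟨ha, h | h | h | h⟩ | ⟨ha, h | h | h⟩ | ⟨ha, h | h | h | h⟩ |
          ⟨ha, h | h | h | h⟩ | ⟨ha, h | h | h⟩ | ⟨ha, h | h | h | h⟩ <;>
        exact no _ _ (by decide) ha h)
    have h3 := boundaryCount_le (X := X) (U := A ∪ B)
      (by simp [(hav A hA).1, (hav B hB).1]) (by simp [(hav A hA).2, (hav B hB).2])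
      (by
        intro x hx y hy hxy
        rcases Finset.mem_union.1 hx with hx | hx
        · exact Finset.mem_union_left _ ((hO A hA).closed x hx y hy hxy)
        · exact Finset.mem_union_right _ ((hO B hB).closed x hx y hy hxy))
    simp only [Finset.mem_union, Bool.decide_or] at h3
    omega

/-- The `i`-th copy of `H` inside `Q`. -/
def hEmb (k : ℕ) (p : Fin (mP k) × Fin 8) : QV k := Sum.inr (Sum.inl p)

lemma hEmb_injective (k : ℕ) : Function.Injective (hEmb k) :=
  Sum.inr_injective.comp Sum.inl_injective

/-- The `i`-th copy of `Q` inside `G_n`. -/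
def qEmb (k n : ℕ) (p : Fin (2 * n + 1) × QV k) : GV k n := Sum.inr p

lemma qEmb_injective (k n : ℕ) : Function.Injective (qEmb k n) := Sum.inr_injective

lemma qgraph_adj_hEmb (k : ℕ) (i : Fin (mP k)) (a b : Fin 8) (h : Hgraph.Adj a b) :
    (Qgraph k).Adj (hEmb k (i, a)) (hEmb k (i, b)) := by
  have := h.ne
  simp [Qgraph, Tgraph, hEmb, h, this]

lemma qgraph_adj_of_inUR (k : ℕ) {s t : TV k} (hs : inUR k s) (ht : inUR k t) (h : s ≠ t) :
    (Qgraph k).Adj (Sum.inr s) (Sum.inr t) := by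
  simp [Qgraph, Tgraph, hs, ht, h]

lemma qgraph_adj_inl (k : ℕ) (a : Fin (lP k)) (x : QV k) (h : x ≠ Sum.inl a) :
    (Qgraph k).Adj x (Sum.inl a) := by
  simp [Qgraph, h]

lemma ggraph_adj_qEmb (k n : ℕ) (i : Fin (2 * n + 1)) (a b : QV k) (h : (Qgraph k).Adj a b) :
    (Ggraph k n).Adj (qEmb k n (i, a)) (qEmb k n (i, b)) := by
  have := h.ne
  simp [Ggraph, qEmb, h, this]

lemma ggraph_adj_inl (k n : ℕ) (a : Fin n) (x : GV k n) (h : x ≠ Sum.inl a) :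
    (Ggraph k n).Adj x (Sum.inl a) := by
  simp [Ggraph, h]

lemma card_QV (k : ℕ) : Fintype.card (QV k) = 2 * k + 1 := by
  simp only [Fintype.card_sum, Fintype.card_prod, Fintype.card_fin]
  unfold rP mP lP
  omega

/-- In `Q - Y` with `L ⊆ Y`, at most one odd closed set meets `U ∪ R`, and the others are counted
inside the copies of `H`. -/
lemma card_oddClosed_qgraph (k : ℕ) (Y : Finset (QV k)) (hL : ∀ a, Sum.inl a ∈ Y)
    (F : Finset (Finset (QV k))) (hF : (F : Set (Finset (QV k))).PairwiseDisjoint id)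
    (hO : ∀ S ∈ F, OddClosed (Qgraph k) Y S) :
    ∃ s : ℕ, F.card ≤ s + 1 ∧ s ≤ 2 * mP k ∧ lP k + 2 * s ≤ Y.card := by
  classical
  set F₀ := F.filter fun S => ∃ t, inUR k t ∧ Sum.inr t ∈ S with hF₀
  set F₁ := F.filter fun S => ¬ ∃ t, inUR k t ∧ Sum.inr t ∈ S with hF₁
  have hF₁F : F₁ ⊆ F := Finset.filter_subset _ _
  have hsplit : F₀.card + F₁.card = F.card := Finset.card_filter_add_card_filter_not _
  have h0 : F₀.card ≤ 1 := by
    refine Finset.card_le_one.2 fun S hS T hT => ?_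
    obtain ⟨hS, s, hs, hsS⟩ := Finset.mem_filter.1 hS
    obtain ⟨hT, t, ht, htT⟩ := Finset.mem_filter.1 hT
    refine eq_of_mem_of_mem hF hS hT ?_ htT
    by_cases hst : s = t
    · exact hst ▸ hsS
    · exact (hO S hS).closed _ hsS _ ((hO T hT).notMem _ htT) (qgraph_adj_of_inUR k hs ht hst)
  have hF₁d : (F₁ : Set (Finset (QV k))).PairwiseDisjoint id :=
    hF.subset (Finset.coe_subset.2 hF₁F)
  have hcov : ∀ S ∈ F₁, ∀ x ∈ S, ∃ p, hEmb k p = x := by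
    intro S hS x hx
    obtain ⟨hS, hn⟩ := Finset.mem_filter.1 hS
    rcases x with a | p | c
    · exact absurd (hL a) ((hO S hS).notMem _ hx)
    · exact ⟨p, rfl⟩
    · exact absurd ⟨Sum.inr c, trivial, hx⟩ hn
  have hfib : ∀ i, ∀ F' : Finset (Finset (Fin 8)),
      (F' : Set (Finset (Fin 8))).PairwiseDisjoint id →
      (∀ T ∈ F', Odd T.card ∧ ∃ S ∈ F₁, T = fibre (hEmb k) i S) →
      F'.card ≤ 2 ∧ 2 * F'.card ≤ (fibre (hEmb k) i Y).card := by
    intro i F' hF' h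
    refine card_oddClosed_hgraph _ F' hF' ?_ ?_
    · intro T hT
      obtain ⟨hodd, S, hS, rfl⟩ := h T hT
      exact (hO S (hF₁F hS)).fibre i (qgraph_adj_hEmb k i) hodd
    · intro T hT
      obtain ⟨-, S, hS, rfl⟩ := h T hT
      have hn := (Finset.mem_filter.1 hS).2
      simp only [mem_fibre]
      exact ⟨fun h' => hn ⟨Sum.inl (i, 0), Or.inl rfl, h'⟩,
        fun h' => hn ⟨Sum.inl (i, 4), Or.inr rfl, h'⟩⟩
  have hodd : ∀ S ∈ F₁, Odd S.card := fun S hS => (hO S (hF₁F hS)).odd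
  have hb1 := card_le_sum_of_fibres (hEmb_injective k) F₁ hF₁d hodd hcov (fun _ => 2)
    fun i F' hF' h => by exact_mod_cast (hfib i F' hF' h).1
  have hb2 := card_le_sum_of_fibres (hEmb_injective k) F₁ hF₁d hodd hcov
    (fun i => ((fibre (hEmb k) i Y).card : ℝ) / 2) fun i F' hF' h => by
      have := (hfib i F' hF' h).2
      rify at this
      linarith
  rw [← Finset.sum_div, le_div_iff₀ (by norm_num)] at hb2
  simp only [Finset.sum_const, Finset.card_univ, Fintype.card_fin, nsmul_eq_mul] at hb1
  norm_cast at hb1 hb2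
  have hY : Y.card = lP k + (∑ i, (fibre (hEmb k) i Y).card +
      ∑ c, if Sum.inr (Sum.inr c) ∈ Y then 1 else 0) := by
    rw [card_eq_sum_ite Y, Fintype.sum_sum_type, Fintype.sum_sum_type, Fintype.sum_prod_type]
    simp only [card_fibre, hL, hEmb, if_true, Finset.sum_const, Finset.card_univ,
      Fintype.card_fin, smul_eq_mul, mul_one]
    congr!
  exact ⟨F₁.card, by omega, by omega, by omega⟩

lemma endpoint_ineq (k : ℕ) (hk : 29 ≤ k) :
    3 * (1 + 2 * (mP k : ℤ)) * (72 * k - 78) ≤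
      (32 * k + 141) * (3 * lP k + 12 * mP k + 1) := by
  obtain ⟨q, t, ht, rfl⟩ : ∃ q t, t < 17 ∧ k = 17 * q + t + 12 :=
    ⟨(k - 12) / 17, (k - 12) % 17, Nat.mod_lt _ (by norm_num), by omega⟩
  have hl : lP (17 * q + t + 12) = 2 * q := by unfold lP; omega
  have hm : mP (17 * q + t + 12) = 4 * q + 3 + (2 * t + 1) / 8 := by
    unfold mP; rw [hl]; omega
  rw [hl, hm]
  interval_cases t <;> norm_num <;> nlinarith

lemma ratio_bound (k : ℕ) (hk : 29 ≤ k) (f s y : ℕ) (hf : f ≤ s + 1) (hs : s ≤ 2 * mP k)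
    (hy : lP k + 2 * s ≤ y) :
    (f : ℝ) ≤ ((32 * (k : ℝ) + 141) / (72 * (k : ℝ) - 78)) * (y + 1 / 3) := by
  have hend := endpoint_ineq k hk
  have hl : 2 ≤ lP k := by unfold lP; omega
  have hm : 1 ≤ mP k := by unfold mP lP; omega
  rify at hend hk hf hs hy hl hm
  rw [div_mul_eq_mul_div, le_div_iff₀ (by linarith)]
  set K : ℝ := (k : ℝ)
  set M : ℝ := (mP k : ℝ)
  set l : ℝ := (lP k : ℝ)
  have h0 : 3 * (72 * K - 78) ≤ (32 * K + 141) * (3 * l + 1) := by nlinarith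
  have hs0 : (0 : ℝ) ≤ s := Nat.cast_nonneg s
  have hlin : 3 * (1 + (s : ℝ)) * (72 * K - 78) ≤ (32 * K + 141) * (3 * l + 6 * s + 1) := by
    have h1 := mul_le_mul_of_nonneg_left h0 (sub_nonneg.2 hs)
    have h2 := mul_le_mul_of_nonneg_left hend hs0
    have hM : 0 < 2 * M := by linarith
    refine le_of_mul_le_mul_left ?_ hM
    linarith
  have h3 : (f : ℝ) * (72 * K - 78) ≤ (s + 1) * (72 * K - 78) :=
    mul_le_mul_of_nonneg_right hf (by linarith)
  have h4 : (32 * K + 141) * (l + 2 * s) ≤ (32 * K + 141) * y :=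
    mul_le_mul_of_nonneg_left hy (by linarith)
  linarith

lemma ratio_ge (k : ℕ) (hk : 29 ≤ k) :
    (3 : ℝ) / 7 ≤ (32 * (k : ℝ) + 141) / (72 * (k : ℝ) - 78) := by
  rify at hk
  rw [div_le_div_iff₀ (by norm_num) (by linarith)]
  linarith

/-- The bound for one copy of `Q`. -/
lemma card_le_qgraph (k : ℕ) (hk : 29 ≤ k) (Y : Finset (QV k)) (F : Finset (Finset (QV k)))
    (hF : (F : Set (Finset (QV k))).PairwiseDisjoint id)
    (hO : ∀ S ∈ F, OddClosed (Qgraph k) Y S) (hsize : ∀ S ∈ F, S.card < 2 * k + 1) :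
    (F.card : ℝ) ≤ ((32 * (k : ℝ) + 141) / (72 * (k : ℝ) - 78)) * (Y.card + 1 / 3) := by
  have hρ := ratio_ge k hk
  by_cases hL : ∀ a, Sum.inl a ∈ Y
  · obtain ⟨s, h1, h2, h3⟩ := card_oddClosed_qgraph k Y hL F hF hO
    exact ratio_bound k hk _ s _ h1 h2 h3
  · push Not at hL
    obtain ⟨a, ha⟩ := hL
    have h1 := card_le_one_of_dominating hF hO ha (qgraph_adj_inl k a)
    rcases F.eq_empty_or_nonempty with rfl | ⟨S, hS⟩
    · simp only [Finset.card_empty, Nat.cast_zero]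
      have : (0 : ℝ) ≤ Y.card := Nat.cast_nonneg _
      exact mul_nonneg (by linarith) (by linarith)
    · have h2 := (hO S hS).card_add_of_dominating ha (qgraph_adj_inl k a)
      rw [card_QV] at h2
      have h3 := hsize S hS
      obtain ⟨c, hc⟩ := (hO S hS).odd
      have h4 : 2 ≤ Y.card := by omega
      rify at h1 h4
      nlinarith

lemma card_le_ggraph (k : ℕ) (hk : 29 ≤ k) (n : ℕ) (hn : 1 ≤ n) (X : Finset (GV k n))
    (F : Finset (Finset (GV k n))) (hF : (F : Set (Finset (GV k n))).PairwiseDisjoint id)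
    (hO : ∀ S ∈ F, OddClosed (Ggraph k n) X S) (hsize : ∀ S ∈ F, S.card < 2 * k + 1) :
    (F.card : ℝ) ≤ ((32 * (k : ℝ) + 141) / (72 * (k : ℝ) - 78)) * X.card := by
  classical
  have hρ := ratio_ge k hk
  by_cases hL : ∀ a, Sum.inl a ∈ X
  · have hcov : ∀ S ∈ F, ∀ x ∈ S, ∃ p, qEmb k n p = x := by
      rintro S hS (a | p) hx
      · exact absurd (hL a) ((hO S hS).notMem _ hx)
      · exact ⟨p, rfl⟩
    have h1 := card_le_sum_of_fibres (qEmb_injective k n) F hF (fun S hS => (hO S hS).odd) hcov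
      (fun i => ((32 * (k : ℝ) + 141) / (72 * (k : ℝ) - 78)) *
        ((fibre (qEmb k n) i X).card + 1 / 3)) (by
      intro i F' hF' h
      refine card_le_qgraph k hk _ F' hF' ?_ ?_
      · intro T hT
        obtain ⟨hodd, S, hS, rfl⟩ := h T hT
        exact (hO S hS).fibre i (ggraph_adj_qEmb k n i) hodd
      · intro T hT
        obtain ⟨-, S, hS, rfl⟩ := h T hT
        exact (card_fibre_le (qEmb_injective k n) i S).trans_lt (hsize S hS))
    have hX : X.card = n + ∑ i, (fibre (qEmb k n) i X).card := by
      rw [card_eq_sum_ite X, Fintype.sum_sum_type, Fintype.sum_prod_type]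
      simp only [card_fibre, hL, qEmb, if_true, Finset.sum_const, Finset.card_univ,
        Fintype.card_fin, smul_eq_mul, mul_one]
      congr!
    rw [← Finset.mul_sum, Finset.sum_add_distrib] at h1
    simp only [Finset.sum_const, Finset.card_univ, Fintype.card_fin, nsmul_eq_mul] at h1
    refine h1.trans (mul_le_mul_of_nonneg_left ?_ (by linarith))
    rw [hX]
    push_cast
    rify at hn
    linarith
  · push Not at hL
    obtain ⟨a, ha⟩ := hL
    have h1 := card_le_one_of_dominating hF hO ha (ggraph_adj_inl k n a)
    rcases F.eq_empty_or_nonempty with rfl | ⟨S, hS⟩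
    · simp only [Finset.card_empty, Nat.cast_zero]
      exact mul_nonneg (by linarith) (Nat.cast_nonneg _)
    · have h2 := (hO S hS).card_add_of_dominating ha (ggraph_adj_inl k n a)
      rw [Fintype.card_sum, Fintype.card_prod, card_QV, Fintype.card_fin, Fintype.card_fin] at h2
      have h3 := hsize S hS
      have h4 : 3 ≤ X.card := by nlinarith
      rify at h1 h4
      nlinarith

/-- The odd components of `G - X` of size less than `2k+1` form a pairwise disjoint family of odd
closed sets. -/
lemma exists_family_of_components {V : Type*} [Fintype V] (G : SimpleGraph V) (X : Finset V)
    (k : ℕ) : ∃ F : Finset (Finset V), (F : Set (Finset V)).PairwiseDisjoint id ∧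
      (∀ S ∈ F, OddClosed G X S) ∧ (∀ S ∈ F, S.card < 2 * k + 1) ∧
      ∑ j ∈ Finset.range k, cComp G (X : Set V) (2 * j + 1) = F.card := by
  classical
  let D : Finset (G.induce (X : Set V)ᶜ).ConnectedComponent :=
    Finset.univ.filter fun C => Odd (Nat.card C.supp) ∧ Nat.card C.supp < 2 * k + 1
  let σ : (G.induce (X : Set V)ᶜ).ConnectedComponent → Finset V :=
    fun C => C.supp.toFinset.map (Function.Embedding.subtype _)
  have hmem : ∀ C x, x ∈ σ C ↔ ∃ h : x ∈ (X : Set V)ᶜ,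
      (G.induce (X : Set V)ᶜ).connectedComponentMk ⟨x, h⟩ = C := by
    intro C x
    simp [σ]
  have hcard : ∀ C, (σ C).card = Nat.card C.supp := by
    intro C
    simp only [σ, Finset.card_map, Set.toFinset_card, Nat.card_eq_fintype_card]
  have hdis : ∀ C C' x, x ∈ σ C → x ∈ σ C' → C = C' := by
    intro C C' x h h'
    obtain ⟨_, rfl⟩ := (hmem C x).1 h
    obtain ⟨_, rfl⟩ := (hmem C' x).1 h'
    rfl
  have hinj : Set.InjOn σ D := by
    intro C hC C' _ h
    have hC := (Finset.mem_filter.1 hC).2.1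
    rw [← hcard] at hC
    obtain ⟨x, hx⟩ := Finset.card_pos.1 hC.pos
    exact hdis C C' x hx (h ▸ hx)
  refine ⟨D.image σ, ?_, ?_, ?_, ?_⟩
  · intro A hA B hB hAB
    obtain ⟨C, -, rfl⟩ := Finset.mem_image.1 hA
    obtain ⟨C', -, rfl⟩ := Finset.mem_image.1 hB
    exact Finset.disjoint_left.2 fun x hx hx' => hAB (congrArg σ (hdis C C' x hx hx'))
  · intro A hA
    obtain ⟨C, hC, rfl⟩ := Finset.mem_image.1 hA
    refine ⟨hcard C ▸ (Finset.mem_filter.1 hC).2.1, ?_, ?_⟩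
    · intro x hx
      obtain ⟨h, -⟩ := (hmem C x).1 hx
      simpa using h
    · intro x hx y hy hxy
      obtain ⟨h, rfl⟩ := (hmem C x).1 hx
      have hy' : y ∈ (X : Set V)ᶜ := by simpa using hy
      refine (hmem _ y).2 ⟨hy', SimpleGraph.ConnectedComponent.sound ?_⟩
      exact SimpleGraph.Adj.reachable
        (show (G.induce (X : Set V)ᶜ).Adj ⟨y, hy'⟩ ⟨x, h⟩ from hxy.symm)
  · intro A hA
    obtain ⟨C, hC, rfl⟩ := Finset.mem_image.1 hA
    exact hcard C ▸ (Finset.mem_filter.1 hC).2.2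
  · rw [Finset.card_image_of_injOn hinj,
      Finset.card_eq_sum_card_fiberwise (f := fun C => Nat.card C.supp / 2)
        (t := Finset.range k)]
    · refine Finset.sum_congr rfl fun j hj => ?_
      rw [cComp, Nat.card_eq_fintype_card, Fintype.card_subtype]
      congr 1
      ext C
      have := Finset.mem_range.1 hj
      simp only [D, Finset.mem_filter, Finset.mem_univ, true_and, Nat.odd_iff]
      omega
    · intro C hC
      have := (Finset.mem_filter.1 hC).2
      rw [Nat.odd_iff] at this
      simp only [Finset.coe_range, Set.mem_Iio]
      omega

/-- For `k ≥ 29`, every integer `n ≥ 1` and every `X ⊆ V(G_n)`,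
`∑_{0 ≤ j ≤ k-1} c_{2j+1}(G_n - X) ≤ ((32k+141)/(72k-78))·|X|`. -/
theorem stmt16 (k : ℕ) (hk : 29 ≤ k) (n : ℕ) (hn : 1 ≤ n) (X : Set (GV k n)) :
    (∑ j ∈ Finset.range k, (cComp (Ggraph k n) X (2 * j + 1) : ℝ)) ≤
      ((32 * (k : ℝ) + 141) / (72 * (k : ℝ) - 78)) * Nat.card X := by
  classical
  obtain ⟨Y, rfl⟩ : ∃ Y : Finset (GV k n), (Y : Set (GV k n)) = X := ⟨X.toFinset, by simp⟩
  obtain ⟨F, hF, hO, hsize, hsum⟩ := exists_family_of_components (Ggraph k n) Y k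
  have h := card_le_ggraph k hk n hn Y F hF hO hsize
  have hY : Nat.card ((Y : Set (GV k n)) : Type) = Y.card := by simp
  rw [hY, ← Nat.cast_sum, hsum]
  exact h
end

section
/- Let k ≥ 2 be an integer and let G be a finite simple graph. Then G has a {P₂, P_{2k+1}}-factor if and only if G has a path-factor F such that no connected component of F is a path of order 2i+1 for any i with 1 ≤ i ≤ k−1. -/
open SimpleGraph

/-- `F` is a `{P₂, P_{2k+1}}`-factor of `G`. -/
def IsP2P2k1Factor {V : Type*} (G : SimpleGraph V) (k : ℕ) (F : SimpleGraph V) : Prop :=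
  F ≤ G ∧ ∀ C : F.ConnectedComponent,
    Nonempty ((F.induce C.supp) ≃g pathGraph 2) ∨
    Nonempty ((F.induce C.supp) ≃g pathGraph (2 * k + 1))

/-- `F` is a path-factor of `G` : a spanning subgraph each of whose connected components is
a path on at least 2 vertices. -/
def IsPathFactor {V : Type*} (G : SimpleGraph V) (F : SimpleGraph V) : Prop :=
  F ≤ G ∧ ∀ C : F.ConnectedComponent,
    ∃ n, 2 ≤ n ∧ Nonempty ((F.induce C.supp) ≃g pathGraph n)

/-- The embedding of a path onto the subpath starting at position `a` of a longer path. -/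
def pathGraphShift (a : ℕ) {m n : ℕ} (h : a + m ≤ n) : pathGraph m ↪g pathGraph n where
  toFun i := ⟨a + i, by omega⟩
  inj' i j hij := by
    simp only [Fin.mk.injEq] at hij
    omega
  map_rel_iff' {i j} := by
    change (pathGraph n).Adj ⟨a + i, _⟩ ⟨a + j, _⟩ ↔ _
    simp only [pathGraph_adj]
    omega

lemma eq_of_pathGraph_iso {W : Type*} {H : SimpleGraph W} {m n : ℕ}
    (e : H ≃g pathGraph m) (f : H ≃g pathGraph n) : m = n := by
  simpa using Fintype.card_congr (e.symm.trans f).toEquiv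

/-- A graph whose vertex set is partitioned into induced paths with orders satisfying `P` has a
spanning subgraph whose components are paths with orders satisfying `P`. -/
lemma exists_pathFactor_of_blocks {V ι : Type*} (F : SimpleGraph V) (b : V → ι) (P : ℕ → Prop)
    (h : ∀ v, ∃ n, P n ∧ ∃ f : pathGraph n ↪g F, Set.range f = {u | b u = b v}) :
    ∃ F' ≤ F, ∀ C : F'.ConnectedComponent,
      ∃ n, P n ∧ Nonempty ((F'.induce C.supp) ≃g pathGraph n) := by
  let F' : SimpleGraph V :=
    { Adj := fun u v => F.Adj u v ∧ b u = b v
      symm := ⟨fun _ _ huv => ⟨huv.1.symm, huv.2.symm⟩⟩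
      loopless := ⟨fun _ hv => hv.1.ne rfl⟩ }
  refine ⟨F', fun _ _ huv => huv.1, fun C => ?_⟩
  induction C using ConnectedComponent.ind with | _ v
  obtain ⟨n, hn, f, hf⟩ := h v
  have hb (i : Fin n) : b (f i) = b v := hf.subset ⟨i, rfl⟩
  have hadj (i j : Fin n) : F'.Adj (f i) (f j) ↔ (pathGraph n).Adj i j :=
    ⟨fun hij => f.map_adj_iff.1 hij.1,
      fun hij => ⟨f.map_adj_iff.2 hij, (hb i).trans (hb j).symm⟩⟩
  have hsupp : Set.range f = (F'.connectedComponentMk v).supp := by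
    ext u
    rw [hf, ConnectedComponent.mem_supp_iff, ConnectedComponent.eq]
    constructor
    · intro hu
      obtain ⟨i, rfl⟩ := hf.superset hu
      obtain ⟨j, hj⟩ := hf.superset (rfl : b v = b v)
      let g : pathGraph n →g F' := ⟨f, fun {i j} => (hadj i j).2⟩
      have := (pathGraph_preconnected n i j).map g
      rwa [show g j = v from hj] at this
    · rintro ⟨w⟩
      clear hadj
      induction w with
      | nil => rfl
      | cons huv _ ih => exact huv.2.trans (ih hf hb)
  refine ⟨n, hn, ⟨Iso.symm
    { toEquiv := (Equiv.ofInjective f f.injective).trans (Equiv.setCongr hsupp)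
      map_rel_iff' := fun {i j} => hadj i j }⟩⟩

/-- The index of the block containing position `j` when a path of order `n` is cut into paths of
order two, preceded by one path of order `2 * k + 1` if `n` is odd. -/
def pathBlock (k n j : ℕ) : ℕ :=
  if Even n then j / 2 else if j < 2 * k + 1 then 0 else (j - (2 * k + 1)) / 2 + 1

lemma exists_pathBlock_eq_iff {k n j : ℕ} (hn : Even n ∨ 2 * k + 1 ≤ n) (hj : j < n) :
    ∃ a m, (m = 2 ∨ m = 2 * k + 1) ∧ a + m ≤ n ∧
      ∀ i, i < n → (pathBlock k n i = pathBlock k n j ↔ a ≤ i ∧ i < a + m) := by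
  unfold pathBlock
  by_cases he : Even n
  · simp only [he, if_true]
    rw [Nat.even_iff] at he
    exact ⟨2 * (j / 2), 2, .inl rfl, by omega, fun i hi => by omega⟩
  · have hn' := hn.resolve_left he
    simp only [he, if_false]
    rw [Nat.even_iff] at he
    by_cases hjk : j < 2 * k + 1
    · refine ⟨0, 2 * k + 1, .inr rfl, by omega, fun i hi => ?_⟩
      split_ifs <;> first | omega | (rw [false_iff]; omega)
    · refine ⟨2 * k + 1 + 2 * ((j - (2 * k + 1)) / 2), 2, .inl rfl, by omega, fun i hi => ?_⟩
      split_ifs <;> first | omega | (rw [false_iff]; omega)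

/-- For `k ≥ 2`, a graph `G` has a `{P₂, P_{2k+1}}`-factor if and only if `G` has a
path-factor `F` such that no connected component of `F` is a path of order `2i+1` for any
`1 ≤ i ≤ k-1`. -/
theorem stmt17 (k : ℕ) (hk : 2 ≤ k) {V : Type} [Fintype V] (G : SimpleGraph V) :
    (∃ F, IsP2P2k1Factor G k F) ↔
    (∃ F, IsPathFactor G F ∧ ∀ C : F.ConnectedComponent, ∀ i : ℕ, 1 ≤ i → i ≤ k - 1 →
      ¬ Nonempty ((F.induce C.supp) ≃g pathGraph (2 * i + 1))) := by
  constructor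
  · rintro ⟨F, hF, hC⟩
    refine ⟨F, ⟨hF, fun C => ?_⟩, fun C i hi hik ⟨e⟩ => ?_⟩
    · rcases hC C with h | h
      · exact ⟨2, le_rfl, h⟩
      · exact ⟨2 * k + 1, by omega, h⟩
    · rcases hC C with ⟨⟨f⟩⟩ | ⟨⟨f⟩⟩ <;> have := eq_of_pathGraph_iso e f <;> omega
  · rintro ⟨F, ⟨hF, hC⟩, hodd⟩
    choose n hn e using hC
    replace e := fun C => (e C).some
    have hlen (C : F.ConnectedComponent) : Even (n C) ∨ 2 * k + 1 ≤ n C := by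
      by_contra! hcon
      obtain ⟨hne, hlt⟩ := hcon
      obtain ⟨i, hi⟩ := Nat.not_even_iff_odd.1 hne
      have := hn C
      exact hodd C i (by omega) (by omega) ⟨hi ▸ e C⟩
    let pos (v : V) : ℕ := e (F.connectedComponentMk v) ⟨v, rfl⟩
    have hpos (C : F.ConnectedComponent) (u : C.supp) : pos u = e C u := by
      obtain ⟨u, rfl⟩ := u
      rfl
    obtain ⟨F', hF', hP⟩ := exists_pathFactor_of_blocks F
      (fun v => (F.connectedComponentMk v, pathBlock k (n (F.connectedComponentMk v)) (pos v)))
      (fun m => m = 2 ∨ m = 2 * k + 1) fun v => by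
        set C := F.connectedComponentMk v with hCv
        obtain ⟨a, m, hm, ham, hblock⟩ := exists_pathBlock_eq_iff (hlen C) (e C ⟨v, rfl⟩).isLt
        refine ⟨m, hm, (Embedding.induce C.supp).comp
          ((e C).symm.toEmbedding.comp (pathGraphShift a ham)), ?_⟩
        ext u
        simp only [Set.mem_range, Set.mem_ofPred_eq, Prod.mk.injEq]
        constructor
        · rintro ⟨i, rfl⟩
          set w : C.supp := (e C).symm (pathGraphShift a ham i) with hw
          change F.connectedComponentMk (w : V) = C ∧
            pathBlock k (n (F.connectedComponentMk (w : V))) (pos w) = _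
          have hwC : F.connectedComponentMk (w : V) = C := w.2
          refine ⟨hwC, ?_⟩
          have hval : pos w = a + i := by
            rw [hpos C w, hw, RelIso.apply_symm_apply]
            rfl
          rw [hval, hwC]
          refine (hblock _ (by omega)).2 ?_
          omega
        · rintro ⟨huC, hu⟩
          have huv := hpos C ⟨u, huC⟩
          rw [show pos u = _ from huv, huC] at hu
          replace hu := (hblock _ (Fin.isLt _)).1 hu
          refine ⟨⟨e C ⟨u, huC⟩ - a, by omega⟩, ?_⟩
          change (((e C).symm (pathGraphShift a ham _) : C.supp) : V) = u
          have : pathGraphShift a ham ⟨e C ⟨u, huC⟩ - a, by omega⟩ = e C ⟨u, huC⟩ :=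
            Fin.ext (Nat.add_sub_cancel' hu.1)
          rw [this, RelIso.symm_apply_apply]
    refine ⟨F', hF'.trans hF, fun C => ?_⟩
    obtain ⟨m, rfl | rfl, h⟩ := hP C
    · exact .inl h
    · exact .inr h
end
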